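/- arXiv:2211.04578 — 2 statements merged into one kernel-verified Lean document; each statement's English description precedes it below -/
import Mathlib

section
/- (Classic Multivariable Chain Rule for Terms) Let f : ℝⁿ → ℝ be everywhere differentiable (in the classical sense), with partial derivatives fⱼ = Dⱼf with respect to its j-th argument. Let T⃗ = (T₁, …, Tₙ) be terms with FV(Tᵢ) ⊆ {v₁, …, vₘ} for each i, where v₁, …, vₘ are distinct variables. Assume that f̄(T⃗) and each of T₁, …, Tₙ are everywhere totally differentiable. Then for every 1 ≤ i ≤ m, ∂(f̄(T⃗))/∂vᵢ ≡ Σ_{j=1}^{n} f̄ⱼ(T⃗)·(∂Tⱼ/∂vᵢ). -/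
open Filter Topology

/-- Variables: `(m, i)` represents the `m`-fold differential `dᵐxᵢ` of the
precalculus variable `xᵢ`.  Unique readability holds by construction. -/
abbrev Var : Type := ℕ × ℕ

/-- The differential variable `dv` associated to a variable `v`. -/
def dvar (v : Var) : Var := (v.1 + 1, v.2)

/-- Terms of differential calculus. -/
inductive Term : Type where
  | var : Var → Term
  | const : ℝ → Term
  | app : (n : ℕ) → ((Fin n → ℝ) → ℝ) → (Fin n → Term) → Term

/-- Assignments of real values to variables. -/
abbrev Assignment : Type := Var → ℝ

/-- Interpretation `Tˢ` of a term `T` under an assignment `s`. -/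
noncomputable def interp : Term → Assignment → ℝ
  | .var v, s => s v
  | .const r, _ => r
  | .app _ f U, s => f fun i => interp (U i) s

/-- The (finite set of) free variables of a term. -/
def FV : Term → Finset Var
  | .var v => {v}
  | .const _ => ∅
  | .app _ _ U => Finset.univ.biUnion fun i => FV (U i)

/-- Semantic equivalence of terms. -/
def TermEquiv (T U : Term) : Prop := ∀ s : Assignment, interp T s = interp U s

/-- The ordered free variables of `T`: its free variables listed in a fixed
canonical order. -/
noncomputable def OFV (T : Term) : List Var := (FV T).toList

/-- `T` is everywhere-differentiable with respect to the variable `w`. -/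
def EDiff (T : Term) (w : Var) : Prop :=
  ∀ s : Assignment, ∃ L : ℝ,
    Tendsto (fun h : ℝ => (interp T (Function.update s w (s w + h)) - interp T s) / h)
      (𝓝[≠] 0) (𝓝 L)

/-- The defining limit of the partial derivative of `T` w.r.t. `w` at `s`. -/
noncomputable def pderivLim (T : Term) (w : Var) (s : Assignment) : ℝ :=
  limUnder (𝓝[≠] (0 : ℝ))
    fun h : ℝ => (interp T (Function.update s w (s w + h)) - interp T s) / h

/-- The canonical assignment sending the `i`-th ordered free variable of `T`
to `r i` (and all other variables to `0`). -/
noncomputable def canonAsgn (T : Term) (r : Fin (OFV T).length → ℝ) : Assignment :=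
  fun v =>
    if hv : v ∈ OFV T then
      r ⟨@List.idxOf Var instBEqOfDecidableEq v (OFV T), (@List.idxOf_lt_length_iff Var instBEqOfDecidableEq _ _ _).mpr hv⟩
    else 0

/-- The formal partial derivative `∂T/∂w`: the term `f̄(v₁,…,vₙ)` where
`(v₁,…,vₙ) = OFV T` and `f` sends `(r₁,…,rₙ)` to the defining limit at any
assignment with `s vᵢ = rᵢ`; it is `0̄` if `FV T = ∅`. -/
noncomputable def pderiv (T : Term) (w : Var) : Term :=
  if (OFV T).length = 0 then .const 0
  else .app (OFV T).length (fun r => pderivLim T w (canonAsgn T r))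
      fun i => .var ((OFV T).get i)

/-- `T` is everywhere totally differentiable. -/
def ETDiff (T : Term) : Prop := ∀ w : Var, EDiff T w

/-- Sum of two terms, via the binary function symbol for addition. -/
def Term.add (T U : Term) : Term := .app 2 (fun r => r 0 + r 1) ![T, U]

/-- Product of two terms, via the binary function symbol for multiplication. -/
def Term.mul (T U : Term) : Term := .app 2 (fun r => r 0 * r 1) ![T, U]

/-- Finite sums of terms. -/
def sumList : List Term → Term
  | [] => .const 0
  | T :: rest => T.add (sumList rest)

/-- Finite products of terms. -/
def prodList : List Term → Term
  | [] => .const 1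
  | T :: rest => T.mul (prodList rest)

/-- The total differential `𝐝T = Σᵢ (∂T/∂vᵢ)·dvᵢ` where `(v₁,…,vₙ) = OFV T`. -/
noncomputable def tdiff (T : Term) : Term :=
  sumList ((OFV T).map fun v => (pderiv T v).mul (.var (dvar v)))

/-- `T` is strongly differentiable: every subterm of `T` is everywhere
totally differentiable. -/
def StronglyDiff : Term → Prop
  | .var v => ETDiff (.var v)
  | .const r => ETDiff (.const r)
  | .app n f U => ETDiff (.app n f U) ∧ ∀ i, StronglyDiff (U i)

/-- The extension of `φ₀ : 𝒱 → Terms` to all terms. -/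
def ext (φ₀ : Var → Term) : Term → Term
  | .var v => φ₀ v
  | .const r => .const r
  | .app n f U => .app n f fun i => ext φ₀ (U i)

/-- `φ₀` respects `d` if `φ₀(dv) ≡ 𝐝(φ₀ v)` for every variable `v`. -/
def RespectsD (φ₀ : Var → Term) : Prop :=
  ∀ v : Var, TermEquiv (φ₀ (dvar v)) (tdiff (φ₀ v))

/-- Substitution respecting differentials `T[v|U]` (for `v` a precalculus
variable): replace `v` by `U` and each `dᵏv` by `𝐝ᵏU`. -/
noncomputable def substD (T : Term) (v : Var) (U : Term) : Term :=
  ext (fun w => if w.2 = v.2 then tdiff^[w.1] U else .var w) T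

theorem interp_congr (T : Term) (s t : Assignment) (h : ∀ v ∈ FV T, s v = t v) :
    interp T s = interp T t := by
  induction T with
  | var v => simpa [interp, FV] using h
  | const r => rfl
  | app n f U ih =>
    simp only [interp]
    congr 1
    funext i
    apply ih i
    intro v hv
    apply h
    simp only [FV, Finset.mem_biUnion, Finset.mem_univ, true_and]
    exact ⟨i, hv⟩

theorem pderivLim_congr (T : Term) (w : Var) (s t : Assignment) (h : ∀ v ∈ FV T, s v = t v) :
    pderivLim T w s = pderivLim T w t := by
  unfold pderivLim
  congr 1
  funext x
  rw [interp_congr T s t h, interp_congr T (Function.update s w (s w + x))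
    (Function.update t w (t w + x))]
  intro v hv
  by_cases hvw : v = w
  · subst hvw
    simp [h v hv]
  · simp [hvw, h v hv]

theorem interp_pderiv (T : Term) (w : Var) (s : Assignment) :
    interp (pderiv T w) s = pderivLim T w s := by
  unfold pderiv
  split_ifs with h
  · have h0 : FV T = ∅ := by simpa [OFV] using h
    have : pderivLim T w s = 0 := by
      unfold pderivLim
      apply Tendsto.limUnder_eq
      have : (fun h : ℝ => (interp T (Function.update s w (s w + h)) - interp T s) / h)
          = fun _ => 0 := by
        funext x
        rw [interp_congr T (Function.update s w (s w + x)) s (by simp [h0])]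
        simp
      rw [this]
      exact tendsto_const_nhds
    rw [this]
    rfl
  · simp only [interp]
    apply pderivLim_congr
    intro v hv
    have hv' : v ∈ OFV T := by simpa [OFV] using hv
    unfold canonAsgn
    rw [dif_pos hv']
    simp

theorem interp_sumList (l : List Term) (s : Assignment) :
    interp (sumList l) s = (l.map fun T => interp T s).sum := by
  induction l with
  | nil => simp [sumList, interp]
  | cons a l ih => simp [sumList, Term.add, interp, ih]

theorem hasDerivAt_of_tendsto (T : Term) (w : Var) (s : Assignment) (L : ℝ) :
    Tendsto (fun h : ℝ => (interp T (Function.update s w (s w + h)) - interp T s) / h)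
      (𝓝[≠] 0) (𝓝 L) ↔
    HasDerivAt (fun h : ℝ => interp T (Function.update s w (s w + h))) L 0 := by
  rw [hasDerivAt_iff_tendsto_slope_zero]
  simp [div_eq_inv_mul]

/-- Classic Multivariable Chain Rule for Terms: if `f : ℝⁿ → ℝ` is everywhere
differentiable with partial derivatives `fⱼ`, the terms `T₁,…,Tₙ` have free
variables among the distinct variables `v₁,…,vₘ`, and `f̄(T⃗)` and each `Tⱼ`
are everywhere totally differentiable, then for each `i`,
`∂(f̄(T⃗))/∂vᵢ ≡ Σⱼ f̄ⱼ(T⃗)·(∂Tⱼ/∂vᵢ)`. -/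
theorem pderiv_app_equiv_sum (n m : ℕ) (f : (Fin n → ℝ) → ℝ)
    (hf : Differentiable ℝ f) (T : Fin n → Term) (v : Fin m → Var)
    (hv : Function.Injective v)
    (hFV : ∀ j : Fin n, FV (T j) ⊆ Finset.univ.image v)
    (hfT : ETDiff (.app n f T)) (hT : ∀ j : Fin n, ETDiff (T j)) (i : Fin m) :
    TermEquiv (pderiv (.app n f T) (v i))
      (sumList ((List.finRange n).map fun j =>
        (Term.app n (fun r => fderiv ℝ f r (Pi.single j 1)) T).mul
          (pderiv (T j) (v i)))) := by
  intro s
  rw [interp_pderiv, interp_sumList, List.map_map]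
  unfold pderivLim
  apply Tendsto.limUnder_eq
  rw [hasDerivAt_of_tendsto]
  have hd : ∀ j, HasDerivAt (fun h : ℝ => interp (T j) (Function.update s (v i) (s (v i) + h)))
      (pderivLim (T j) (v i) s) 0 := by
    intro j
    obtain ⟨L, hL⟩ := hT j (v i) s
    have : pderivLim (T j) (v i) s = L := hL.limUnder_eq
    rw [this]
    exact (hasDerivAt_of_tendsto _ _ _ _).1 hL
  have hp := hasDerivAt_pi.2 hd
  have hc := (hf (fun j => interp (T j)
    (Function.update s (v i) (s (v i) + 0)))).hasFDerivAt.comp_hasDerivAt (0 : ℝ) hp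
  simp only [interp]
  refine hc.congr_deriv ?_
  simp only [add_zero, Function.update_eq_self]
  rw [← List.ofFn_eq_map, List.sum_ofFn]
  conv_lhs => rw [pi_eq_sum_univ' (fun j => pderivLim (T j) (v i) s), map_sum]
  apply Finset.sum_congr rfl
  intro j _
  rw [map_smul]
  have : (fun k => if j = k then (1:ℝ) else 0) = Pi.single j 1 := by
    funext k
    simp [Pi.single_apply, eq_comm]
  simp [Term.mul, interp, interp_pderiv, mul_comm, Pi.single_apply, this]
end

section
/- (Faà di Bruno's formula, combinatorial form) Let f, g : ℝ → ℝ be infinitely differentiable functions and let n ≥ 1 be an integer. Then for every x ∈ ℝ, the n-th derivative of the composite satisfies (f ∘ g)⁽ⁿ⁾(x) = Σ_{π ∈ Πₙ} f^(|π|)(g(x)) · Π_{B ∈ π} g^(|B|)(x), where Πₙ is the set of all partitions of the set {1, …, n}, |π| is the number of blocks of the partition π, and |B| is the cardinality of the block B. -/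
/-- `π` is a partition of `{1,…,n}` (represented as `Fin n`): a collection of
pairwise disjoint nonempty blocks whose union is everything, i.e. every
element lies in exactly one block and no block is empty. -/
def IsPartitionOf (n : ℕ) (π : Finset (Finset (Fin n))) : Prop :=
  (∀ B ∈ π, B.Nonempty) ∧ ∀ i : Fin n, ∃! B : Finset (Fin n), B ∈ π ∧ i ∈ B

namespace FdB

open Classical in
noncomputable def blk {n : ℕ} (c : OrderedFinpartition n) (m : Fin c.length) : Finset (Fin n) :=
  Finset.univ.image (c.emb m)

def top {n : ℕ} (c : OrderedFinpartition n) (m : Fin c.length) : Fin n :=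
  c.emb m ⟨c.partSize m - 1, Nat.sub_one_lt_of_lt (c.partSize_pos m)⟩

lemma mem_blk {n : ℕ} (c : OrderedFinpartition n) (m : Fin c.length) (i : Fin n) :
    i ∈ blk c m ↔ ∃ r, c.emb m r = i := by
  simp [blk]

lemma top_mem {n : ℕ} (c : OrderedFinpartition n) (m : Fin c.length) : top c m ∈ blk c m :=
  (mem_blk c m _).2 ⟨_, rfl⟩

lemma le_top {n : ℕ} (c : OrderedFinpartition n) (m : Fin c.length) {i : Fin n}
    (h : i ∈ blk c m) : i ≤ top c m := by
  obtain ⟨r, rfl⟩ := (mem_blk c m _).1 h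
  apply (c.emb_strictMono m).monotone
  rw [Fin.le_def]
  have := r.2
  simp only
  omega

lemma blk_eq_of_mem {n : ℕ} (c : OrderedFinpartition n) {m m' : Fin c.length} {i : Fin n}
    (h : i ∈ blk c m) (h' : i ∈ blk c m') : m = m' := by
  obtain ⟨r, rfl⟩ := (mem_blk c m _).1 h
  obtain ⟨r', hr⟩ := (mem_blk c m' _).1 h'
  by_contra hne
  exact c.emb_ne_emb_of_ne hne hr.symm

lemma blk_inj {n : ℕ} (c : OrderedFinpartition n) : Function.Injective (blk c) := by
  intro m m' h
  exact blk_eq_of_mem c (top_mem c m) (h ▸ top_mem c m)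

lemma card_blk {n : ℕ} (c : OrderedFinpartition n) (m : Fin c.length) :
    (blk c m).card = c.partSize m := by
  rw [blk, Finset.card_image_of_injective _ (c.emb_strictMono m).injective]
  simp

open Classical in
noncomputable def parts {n : ℕ} (c : OrderedFinpartition n) : Finset (Finset (Fin n)) :=
  Finset.univ.image (blk c)

lemma mem_parts {n : ℕ} (c : OrderedFinpartition n) (B : Finset (Fin n)) :
    B ∈ parts c ↔ ∃ m, blk c m = B := by
  simp [parts]

lemma card_parts {n : ℕ} (c : OrderedFinpartition n) : (parts c).card = c.length := by
  rw [parts, Finset.card_image_of_injective _ (blk_inj c)]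
  simp

lemma isPartition {n : ℕ} (c : OrderedFinpartition n) : IsPartitionOf n (parts c) := by
  refine ⟨?_, ?_⟩
  · intro B hB
    obtain ⟨m, rfl⟩ := (mem_parts c B).1 hB
    exact ⟨_, top_mem c m⟩
  · intro i
    obtain ⟨m, r, hr⟩ := c.cover i
    have hi : i ∈ blk c m := (mem_blk c m i).2 ⟨r, hr⟩
    refine ⟨blk c m, ⟨(mem_parts c _).2 ⟨m, rfl⟩, hi⟩, ?_⟩
    rintro B ⟨hB, hiB⟩
    obtain ⟨m', rfl⟩ := (mem_parts c B).1 hB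
    rw [blk_eq_of_mem c hi hiB]

lemma range_top {n : ℕ} (c : OrderedFinpartition n) :
    Set.range (top c) = {i | ∃ B ∈ parts c, i ∈ B ∧ ∀ j ∈ B, j ≤ i} := by
  ext i
  constructor
  · rintro ⟨m, rfl⟩
    exact ⟨blk c m, (mem_parts c _).2 ⟨m, rfl⟩, top_mem c m, fun j hj => le_top c m hj⟩
  · rintro ⟨B, hB, hi, hj⟩
    obtain ⟨m, rfl⟩ := (mem_parts c B).1 hB
    exact ⟨m, le_antisymm (hj _ (top_mem c m)) (le_top c m hi)⟩

lemma emb_range {n : ℕ} (c : OrderedFinpartition n) (m) : Set.range (c.emb m) = blk c m := by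
  simp [blk]

lemma parts_inj {n : ℕ} : Function.Injective (parts (n := n)) := by
  intro c c' h
  have hl : c.length = c'.length := by rw [← card_parts, ← card_parts, h]
  have hr : Set.range (top c) = Set.range (top c') := by rw [range_top, range_top, h]
  have hsub : ∀ m, blk c m ∈ parts c' := fun m => h ▸ (mem_parts c _).2 ⟨m, rfl⟩
  have ht : StrictMono (top c) := c.parts_strictMono
  have ht' : StrictMono (top c') := c'.parts_strictMono
  have hb : ∀ m : Fin c.length, blk c m = blk c' (Fin.cast hl m) := by
    have e : top c = top c' ∘ Fin.cast hl := by
      apply (ht.range_inj (ht'.comp (Fin.cast_strictMono hl))).1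
      rw [hr]
      exact ((finCongr hl).surjective.range_comp (top c')).symm
    intro m
    obtain ⟨m', hm'⟩ := (mem_parts c' _).1 (hsub m)
    have h1 : top c m ∈ blk c' m' := hm' ▸ top_mem c m
    have h2 : top c m ∈ blk c' (Fin.cast hl m) := by
      rw [e]; exact top_mem c' _
    rw [← hm', blk_eq_of_mem c' h1 h2]
  have hp : ∀ m : Fin c.length, c.partSize m = c'.partSize (Fin.cast hl m) := by
    intro m
    rw [← card_blk, ← card_blk, hb]
  have he : ∀ m : Fin c.length, Set.range (c.emb m) = Set.range (c'.emb (Fin.cast hl m)) := by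
    intro m
    rw [emb_range, emb_range, hb]
  clear hb hsub ht ht' hr h
  rcases c with ⟨l, p, hpos, emb, hs, hps, hd, hc⟩
  rcases c' with ⟨l', p', hpos', emb', hs', hps', hd', hc'⟩
  dsimp only at hl
  subst hl
  obtain rfl : p = p' := funext hp
  obtain rfl : emb = emb' := by
    funext m
    exact ((hs m).range_inj (hs' m)).1 (he m)
  rfl

lemma parts_surj {n : ℕ} (π : Finset (Finset (Fin n))) (h : IsPartitionOf n π) :
    ∃ c : OrderedFinpartition n, parts c = π := by
  classical
  obtain ⟨hne, hu⟩ := h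
  let T : Finset (Fin n) := Finset.univ.filter fun i => ∃ B ∈ π, i ∈ B ∧ ∀ j ∈ B, j ≤ i
  have hT : ∀ m : Fin T.card, ∃ B ∈ π, T.orderEmbOfFin rfl m ∈ B ∧
      ∀ j ∈ B, j ≤ T.orderEmbOfFin rfl m := fun m =>
    (Finset.mem_filter.1 (T.orderEmbOfFin_mem rfl m)).2
  choose b hbπ hbm hbl using hT
  have huniq : ∀ {i B B'}, B ∈ π → B' ∈ π → i ∈ B → i ∈ B' → B = B' := by
    intro i B B' h1 h2 h3 h4
    exact (hu i).unique ⟨h1, h3⟩ ⟨h2, h4⟩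
  have hbsurj : ∀ B ∈ π, ∃ m, b m = B := by
    intro B hB
    have hm := B.max'_mem (hne B hB)
    have : B.max' (hne B hB) ∈ T := by
      simp only [T, Finset.mem_filter, Finset.mem_univ, true_and]
      exact ⟨B, hB, hm, fun j hj => B.le_max' j hj⟩
    have h2 : B.max' (hne B hB) ∈ Set.range (T.orderEmbOfFin rfl) := by
      rw [Finset.range_orderEmbOfFin]; exact this
    obtain ⟨m, hm2⟩ := h2
    exact ⟨m, huniq (hbπ m) hB (hbm m) (hm2 ▸ hm)⟩
  have hpos : ∀ m, 0 < (b m).card := fun m => Finset.card_pos.2 (hne _ (hbπ m))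
  have hlast : ∀ m, (b m).orderEmbOfFin rfl ⟨(b m).card - 1, Nat.sub_one_lt_of_lt (hpos m)⟩
      = T.orderEmbOfFin rfl m := by
    intro m
    rw [Finset.orderEmbOfFin_last rfl (hpos m)]
    exact le_antisymm (hbl m _ (Finset.max'_mem _ _)) (Finset.le_max' _ _ (hbm m))
  let c : OrderedFinpartition n :=
    { length := T.card
      partSize := fun m => (b m).card
      partSize_pos := hpos
      emb := fun m => (b m).orderEmbOfFin rfl
      emb_strictMono := fun m => ((b m).orderEmbOfFin rfl).strictMono
      parts_strictMono := by
        simp only [hlast]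
        exact (T.orderEmbOfFin rfl).strictMono
      disjoint := by
        intro m _ m' _ hmm
        simp only [Function.onFun, Finset.range_orderEmbOfFin]
        rw [Finset.disjoint_coe, Finset.disjoint_left]
        intro i hi hi'
        have e := huniq (hbπ m) (hbπ m') hi hi'
        apply hmm
        apply (T.orderEmbOfFin rfl).injective
        exact le_antisymm (hbl m' _ (e ▸ hbm m)) (hbl m _ (e ▸ hbm m'))
      cover := by
        intro i
        obtain ⟨B, ⟨hB, hi⟩, _⟩ := hu i
        obtain ⟨m, rfl⟩ := hbsurj B hB
        refine ⟨m, ?_⟩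
        rw [Finset.range_orderEmbOfFin]
        exact hi }
  have hcb : ∀ m, blk c m = b m := by
    intro m
    apply Finset.coe_injective
    rw [← emb_range]
    exact Finset.range_orderEmbOfFin _ _
  refine ⟨c, ?_⟩
  ext B
  rw [mem_parts]
  constructor
  · rintro ⟨m, rfl⟩
    rw [hcb]; exact hbπ m
  · intro hB
    obtain ⟨m, hm⟩ := hbsurj B hB
    exact ⟨m, (hcb m).trans hm⟩

end FdB

/- Faà di Bruno's formula, combinatorial form: for infinitely differentiable
`f, g : ℝ → ℝ` and `n ≥ 1`,
`(f ∘ g)⁽ⁿ⁾(x) = Σ_{π ∈ Πₙ} f^(|π|)(g x) · Π_{B ∈ π} g^(|B|)(x)`. -/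
open Classical in
theorem faa_di_bruno (f g : ℝ → ℝ) (hf : ContDiff ℝ (⊤ : ℕ∞) f) (hg : ContDiff ℝ (⊤ : ℕ∞) g)
    (n : ℕ) (hn : 1 ≤ n) (x : ℝ) :
    iteratedDeriv n (f ∘ g) x =
      ∑ π ∈ Finset.univ.filter (IsPartitionOf n),
        iteratedDeriv π.card f (g x) * ∏ B ∈ π, iteratedDeriv B.card g x := by
  rw [iteratedDeriv_comp_eq_sum_orderedFinpartition hf.contDiffAt hg.contDiffAt
    (by exact_mod_cast le_top)]
  refine Finset.sum_bij (fun c _ => FdB.parts c) ?_ ?_ ?_ ?_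
  · intro c _
    exact Finset.mem_filter.2 ⟨Finset.mem_univ _, FdB.isPartition c⟩
  · intro c _ c' _ h
    exact FdB.parts_inj h
  · intro π hπ
    obtain ⟨c, hc⟩ := FdB.parts_surj π (Finset.mem_filter.1 hπ).2
    exact ⟨c, Finset.mem_univ _, hc⟩
  · intro c _
    rw [FdB.card_parts, FdB.parts, Finset.prod_image (fun a _ b _ h => FdB.blk_inj c h)]
    simp only [FdB.card_blk]
end
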